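/- Assume the sampled-data surrogate setup and additionally: (i) A₀Ψ(0) = 0 and B₀Ψ(0) = 0; (ii) ‖exp(t·A(u)) − exp(t·B(u))‖ ≤ ε for all t ∈ [0,Δt] and all u ∈ U; (iii) ‖(A_i − B_i)Ψ(0)‖ ≤ ε for all i ∈ [1:n_c]; and let ε ∈ (0, ε₀]. Set C* := sup_{u∈U} ‖A(u)‖ and c̃ := √(n_c) · ( max_{i∈[1:n_c]} ‖A_i Ψ(0)‖ + ε₀ + e^{Δt·C*} ). Then for all x ∈ X and u ∈ U, ‖f(x,u) − f^ε(x,u)‖ ≤ ε · ( L_Ψ·‖x‖ + Δt·c̃·‖u‖ ). -/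

import Mathlib

open scoped BigOperators

/-- The control-affine family of (lifted) generator matrices
`A(u) = A₀ + ∑ i, u i • (A i - A₀)`. -/
noncomputable def ctrlAff {M n : ℕ}
    (A₀ : EuclideanSpace ℝ (Fin M) →L[ℝ] EuclideanSpace ℝ (Fin M))
    (A : Fin n → EuclideanSpace ℝ (Fin M) →L[ℝ] EuclideanSpace ℝ (Fin M))
    (u : EuclideanSpace ℝ (Fin n)) :
    EuclideanSpace ℝ (Fin M) →L[ℝ] EuclideanSpace ℝ (Fin M) :=
  A₀ + ∑ i, u i • (A i - A₀)

/-- The exponential of a continuous endomorphism is bounded by the real exponential of its norm. -/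
theorem norm_exp_le_exp_norm_clm {E : Type*} [NormedAddCommGroup E] [NormedSpace ℝ E]
    [CompleteSpace E] (T : E →L[ℝ] E) : ‖NormedSpace.exp T‖ ≤ Real.exp ‖T‖ := by
  have hT := NormedSpace.exp_series_hasSum_exp' (𝕂 := ℝ) T
  have hr := NormedSpace.exp_series_hasSum_exp' (𝕂 := ℝ) ‖T‖
  rw [← Real.exp_eq_exp_ℝ] at hr
  refine hT.norm_le_of_bounded hr fun n => ?_
  have hpow : ‖T ^ n‖ ≤ ‖T‖ ^ n := by
    rcases n with _ | n
    · rw [pow_zero, pow_zero]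
      exact ContinuousLinearMap.norm_id_le
    · exact norm_pow_le' T n.succ_pos
  rw [norm_smul, smul_eq_mul, Real.norm_of_nonneg (by positivity)]
  gcongr

theorem EuclideanSpace.sum_abs_le_sqrt_mul_norm {n : ℕ} (u : EuclideanSpace ℝ (Fin n)) :
    ∑ i, |u i| ≤ Real.sqrt n * ‖u‖ := by
  rw [EuclideanSpace.norm_eq, ← Real.sqrt_mul n.cast_nonneg]
  refine Real.le_sqrt_of_sq_le ?_
  simpa using sq_sum_le_card_mul_sum_sq (s := Finset.univ) (f := fun i => |u i|)

theorem EuclideanSpace.norm_sum_smul_le {n : ℕ} {E : Type*} [NormedAddCommGroup E]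
    [NormedSpace ℝ E] (u : EuclideanSpace ℝ (Fin n)) (v : Fin n → E) {c : ℝ} (hc : 0 ≤ c)
    (hv : ∀ i, ‖v i‖ ≤ c) : ‖∑ i, u i • v i‖ ≤ Real.sqrt n * ‖u‖ * c := by
  calc ‖∑ i, u i • v i‖ ≤ ∑ i, |u i| * c := norm_sum_le_of_le _ fun i _ => by
        rw [norm_smul, Real.norm_eq_abs]
        exact mul_le_mul_of_nonneg_left (hv i) (abs_nonneg _)
    _ = (∑ i, |u i|) * c := (Finset.sum_mul ..).symm
    _ ≤ Real.sqrt n * ‖u‖ * c :=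
        mul_le_mul_of_nonneg_right (EuclideanSpace.sum_abs_le_sqrt_mul_norm u) hc

theorem ctrlAff_apply_of_drift_eq_zero {M n : ℕ}
    {A₀ : EuclideanSpace ℝ (Fin M) →L[ℝ] EuclideanSpace ℝ (Fin M)}
    (A : Fin n → EuclideanSpace ℝ (Fin M) →L[ℝ] EuclideanSpace ℝ (Fin M))
    (u : EuclideanSpace ℝ (Fin n)) {z : EuclideanSpace ℝ (Fin M)} (hz : A₀ z = 0) :
    ctrlAff A₀ A u z = ∑ i, u i • A i z := by
  simp [ctrlAff, hz]

theorem continuous_ctrlAff {M n : ℕ}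
    (A₀ : EuclideanSpace ℝ (Fin M) →L[ℝ] EuclideanSpace ℝ (Fin M))
    (A : Fin n → EuclideanSpace ℝ (Fin M) →L[ℝ] EuclideanSpace ℝ (Fin M)) :
    Continuous (ctrlAff A₀ A) := by
  unfold ctrlAff
  fun_prop

/-- If the exponentials of `S` and `T` are `ε`-close on `[0, τ]`, their orbits through `z` drift
apart at a rate controlled by `T z` and `S z - T z`. -/
theorem norm_exp_apply_sub_exp_apply_le {E : Type*} [NormedAddCommGroup E] [NormedSpace ℝ E]
    [CompleteSpace E] (S T : E →L[ℝ] E) (z : E) {τ ε : ℝ} (hτ : 0 ≤ τ)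
    (h : ∀ t ∈ Set.Icc 0 τ, ‖NormedSpace.exp (t • S) - NormedSpace.exp (t • T)‖ ≤ ε) :
    ‖NormedSpace.exp (τ • S) z - NormedSpace.exp (τ • T) z‖ ≤
      (ε * ‖T z‖ + Real.exp (τ * ‖S‖) * ‖S z - T z‖) * τ := by
  have hderiv (R : E →L[ℝ] E) (t : ℝ) :
      HasDerivAt (fun s : ℝ => NormedSpace.exp (s • R) z) (NormedSpace.exp (t • R) (R z)) t := by
    simpa using (hasDerivAt_exp_smul_const R t).clm_apply (hasDerivAt_const t z)
  have hmvt := norm_image_sub_le_of_norm_deriv_le_segment' (a := 0) (b := τ)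
    (f := fun s : ℝ => NormedSpace.exp (s • S) z - NormedSpace.exp (s • T) z)
    (C := ε * ‖T z‖ + Real.exp (τ * ‖S‖) * ‖S z - T z‖)
    (fun t _ => ((hderiv S t).sub (hderiv T t)).hasDerivWithinAt) (fun t ht => ?_)
    τ (Set.right_mem_Icc.2 hτ)
  · simpa using hmvt
  · have hsplit : NormedSpace.exp (t • S) (S z) - NormedSpace.exp (t • T) (T z) =
        (NormedSpace.exp (t • S) - NormedSpace.exp (t • T)) (T z) +
          NormedSpace.exp (t • S) (S z - T z) := by
      simp only [sub_apply, map_sub]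
      abel
    have hS : ‖NormedSpace.exp (t • S)‖ ≤ Real.exp (τ * ‖S‖) := by
      refine (norm_exp_le_exp_norm_clm _).trans (Real.exp_le_exp.2 ?_)
      rw [norm_smul, Real.norm_of_nonneg ht.1]
      exact mul_le_mul_of_nonneg_right ht.2.le (norm_nonneg _)
    rw [hsplit]
    exact norm_add_le_of_le
      (ContinuousLinearMap.le_of_opNorm_le _ (h t (Set.Ico_subset_Icc_self ht)) _)
      (ContinuousLinearMap.le_of_opNorm_le _ hS _)

/-- Proposition 2: proportional error bound for the EDMD-based
sampled-data surrogate model: the prediction error of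
`f(x,u) = P exp(Δt A(u)) Ψ(x)` versus `fᵉ(x,u) = P exp(Δt B(u)) Ψ(x)` is
bounded by `ε (L_Ψ ‖x‖ + Δt c̃ ‖u‖)`. -/
theorem stmt_6 (nx nc M : ℕ)
    (X : Set (EuclideanSpace ℝ (Fin nx))) (hX : IsCompact X) (h0X : (0 : EuclideanSpace ℝ (Fin nx)) ∈ X)
    (U : Set (EuclideanSpace ℝ (Fin nc))) (hU : IsCompact U)
    (Δt : ℝ) (hΔt : 0 < Δt)
    (Ψ : EuclideanSpace ℝ (Fin nx) → EuclideanSpace ℝ (Fin M)) (LΨ : ℝ)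
    (hΨ : ∀ x ∈ X, ∀ y ∈ X, ‖Ψ x - Ψ y‖ ≤ LΨ * ‖x - y‖)
    (P : EuclideanSpace ℝ (Fin M) →L[ℝ] EuclideanSpace ℝ (Fin nx)) (hP : ‖P‖ ≤ 1)
    (A₀ B₀ : EuclideanSpace ℝ (Fin M) →L[ℝ] EuclideanSpace ℝ (Fin M))
    (A B : Fin nc → EuclideanSpace ℝ (Fin M) →L[ℝ] EuclideanSpace ℝ (Fin M))
    (ε ε₀ : ℝ) (hε : ε ∈ Set.Ioc 0 ε₀)
    -- (i) the drift generator and its estimator annihilate the dictionary value at 0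
    (hA0 : A₀ (Ψ 0) = 0) (hB0 : B₀ (Ψ 0) = 0)
    -- (ii) error bound for the exponentials on [0, Δt]
    (hexp : ∀ t ∈ Set.Icc (0 : ℝ) Δt, ∀ u ∈ U,
      ‖NormedSpace.exp (t • ctrlAff A₀ A u) - NormedSpace.exp (t • ctrlAff B₀ B u)‖ ≤ ε)
    -- (iii) generator estimation error on Ψ(0)
    (hgen : ∀ i, ‖(A i - B i) (Ψ 0)‖ ≤ ε) :
    ∀ x ∈ X, ∀ u ∈ U,
      ‖P (NormedSpace.exp (Δt • ctrlAff A₀ A u) (Ψ x)) -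
          P (NormedSpace.exp (Δt • ctrlAff B₀ B u) (Ψ x))‖ ≤
        ε * (LΨ * ‖x‖ +
          Δt * (Real.sqrt nc * ((⨆ i, ‖A i (Ψ 0)‖) + ε₀ +
            Real.exp (Δt * ⨆ w : U, ‖ctrlAff A₀ A (w : EuclideanSpace ℝ (Fin nc))‖))) * ‖u‖) := by
  intro x hx u hu
  obtain ⟨hε0, hεε₀⟩ := hε
  set m := ⨆ i, ‖A i (Ψ 0)‖
  set C := ⨆ w : U, ‖ctrlAff A₀ A (w : EuclideanSpace ℝ (Fin nc))‖
  set S := ctrlAff A₀ A u with hS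
  set T := ctrlAff B₀ B u with hT
  have hm0 : 0 ≤ m := Real.iSup_nonneg fun i => norm_nonneg _
  have hAm (i : Fin nc) : ‖A i (Ψ 0)‖ ≤ m :=
    le_ciSup (f := fun i => ‖A i (Ψ 0)‖) (Set.finite_range _).bddAbove i
  have hSC : ‖S‖ ≤ C := by
    have hbdd := (hU.image (continuous_ctrlAff A₀ A).norm).bddAbove
    rw [Set.image_eq_range] at hbdd
    exact le_ciSup hbdd ⟨u, hu⟩
  have hBm (i : Fin nc) : ‖B i (Ψ 0)‖ ≤ m + ε₀ := by
    have hle := norm_sub_le (A i (Ψ 0)) ((A i - B i) (Ψ 0))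
    rw [sub_apply, sub_sub_cancel, ← sub_apply] at hle
    linarith [hAm i, hgen i]
  have hTz : ‖T (Ψ 0)‖ ≤ Real.sqrt nc * ‖u‖ * (m + ε₀) := by
    rw [hT, ctrlAff_apply_of_drift_eq_zero B u hB0]
    exact EuclideanSpace.norm_sum_smul_le u _ (by linarith) hBm
  have hSTz : ‖S (Ψ 0) - T (Ψ 0)‖ ≤ Real.sqrt nc * ‖u‖ * ε := by
    rw [hS, hT, ctrlAff_apply_of_drift_eq_zero A u hA0, ctrlAff_apply_of_drift_eq_zero B u hB0,
      ← Finset.sum_sub_distrib]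
    simp only [← smul_sub]
    exact EuclideanSpace.norm_sum_smul_le u _ hε0.le hgen
  have hzero : ‖(NormedSpace.exp (Δt • S) - NormedSpace.exp (Δt • T)) (Ψ 0)‖ ≤
      (ε * (Real.sqrt nc * ‖u‖ * (m + ε₀)) +
        Real.exp (Δt * C) * (Real.sqrt nc * ‖u‖ * ε)) * Δt := by
    refine (norm_exp_apply_sub_exp_apply_le S T (Ψ 0) hΔt.le fun t ht => hexp t ht u hu).trans ?_
    gcongr
  have hdiff : ‖(NormedSpace.exp (Δt • S) - NormedSpace.exp (Δt • T)) (Ψ x - Ψ 0)‖ ≤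
      ε * (LΨ * ‖x‖) := by
    have hLip := hΨ x hx 0 h0X
    rw [sub_zero] at hLip
    exact (ContinuousLinearMap.le_of_opNorm_le _
      (hexp Δt (Set.right_mem_Icc.2 hΔt.le) u hu) _).trans
        (mul_le_mul_of_nonneg_left hLip hε0.le)
  calc ‖P (NormedSpace.exp (Δt • S) (Ψ x)) - P (NormedSpace.exp (Δt • T) (Ψ x))‖
      = ‖P ((NormedSpace.exp (Δt • S) - NormedSpace.exp (Δt • T)) (Ψ x))‖ := by
        rw [sub_apply, P.map_sub]
    _ ≤ ‖(NormedSpace.exp (Δt • S) - NormedSpace.exp (Δt • T)) (Ψ x)‖ := by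
        exact (P.le_of_opNorm_le hP _).trans_eq (one_mul _)
    _ = ‖(NormedSpace.exp (Δt • S) - NormedSpace.exp (Δt • T)) (Ψ x - Ψ 0) +
          (NormedSpace.exp (Δt • S) - NormedSpace.exp (Δt • T)) (Ψ 0)‖ := by
        rw [← ContinuousLinearMap.map_add, sub_add_cancel]
    _ ≤ _ := norm_add_le_of_le hdiff hzero
    _ = _ := by ring
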